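/- arXiv:1411.6156 — 3 statements merged into one kernel-verified Lean document; each statement's English description precedes it below -/
import Mathlib

section
/- (Structural property.) For any node u ∈ V and any subset S ⊆ V∖{u} such that ∂u ⊄ S, there exists a neighbor i ∈ ∂u∖S whose average conditional influence satisfies ν̄(u,i,S) ≥ 2τ*, where τ* = α²·δ^{4d+1}/(16dβ). -/
noncomputable section

open Real Finset

/-- The spin value (±1) associated to a Boolean. -/
def spin (b : Bool) : ℝ := if b then 1 else -1

/-- The energy (Hamiltonian, without normalization) of a configuration of the Ising model:
`Σ_{{i,j}∈E} θ_{ij} x_i x_j + Σ_{i∈V} θ_i x_i`, where the sum over edges is written as half the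
sum over ordered adjacent pairs (the edge couplings are symmetric). -/
def energy {p : ℕ} (G : SimpleGraph (Fin p)) [DecidableRel G.Adj]
    (θe : Fin p → Fin p → ℝ) (θv : Fin p → ℝ) (x : Fin p → Bool) : ℝ :=
  (∑ i, ∑ j, if G.Adj i j then θe i j * spin (x i) * spin (x j) else 0) / 2
    + ∑ i, θv i * spin (x i)

/-- The Ising model probability mass function
`P(x) = exp(Σ_{{i,j}∈E} θ_{ij} x_i x_j + Σ_{i∈V} θ_i x_i − Φ(θ))`. -/
def isingPMF {p : ℕ} (G : SimpleGraph (Fin p)) [DecidableRel G.Adj]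
    (θe : Fin p → Fin p → ℝ) (θv : Fin p → ℝ) (x : Fin p → Bool) : ℝ :=
  Real.exp (energy G θe θv x) / ∑ y : Fin p → Bool, Real.exp (energy G θe θv y)

open Classical in
/-- Probability of an event under a pmf on configurations. -/
def prob {p : ℕ} (μ : (Fin p → Bool) → ℝ) (A : (Fin p → Bool) → Prop) : ℝ :=
  ∑ x : Fin p → Bool, if A x then μ x else 0

/-- Conditional probability `P(A | B)`. -/
def condProb {p : ℕ} (μ : (Fin p → Bool) → ℝ) (A B : (Fin p → Bool) → Prop) : ℝ :=
  prob μ (fun x => A x ∧ B x) / prob μ B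

open Classical in
/-- Conditional expectation `E[f(X) | B]`. -/
def condExp {p : ℕ} (μ : (Fin p → Bool) → ℝ) (B : (Fin p → Bool) → Prop)
    (f : (Fin p → Bool) → ℝ) : ℝ :=
  (∑ x : Fin p → Bool, if B x then μ x * f x else 0) / prob μ B

/-- The event `X_S = σ_S` (agreement with `σ` on the set `S`). -/
def agree {p : ℕ} (S : Finset (Fin p)) (σ : Fin p → Bool) (x : Fin p → Bool) : Prop :=
  ∀ i ∈ S, x i = σ i

/-- The conditional influence
`ν_{u|i;x_S} = P(X_u=+1 | X_i=+1, X_S=x_S) − P(X_u=+1 | X_i=−1, X_S=x_S)`. -/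
def condInf {p : ℕ} (μ : (Fin p → Bool) → ℝ) (u i : Fin p) (S : Finset (Fin p))
    (σ : Fin p → Bool) : ℝ :=
  condProb μ (fun x => x u = true) (fun x => x i = true ∧ agree S σ x)
    - condProb μ (fun x => x u = true) (fun x => x i = false ∧ agree S σ x)

/-- The weight `λ_i(x_S) = 2·P(X_i=+1|X_S=x_S)·P(X_i=−1|X_S=x_S)`. -/
def lamWeight {p : ℕ} (μ : (Fin p → Bool) → ℝ) (i : Fin p) (S : Finset (Fin p))
    (σ : Fin p → Bool) : ℝ :=
  2 * condProb μ (fun x => x i = true) (agree S σ)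
    * condProb μ (fun x => x i = false) (agree S σ)

/-- The average conditional influence `ν̄(u,i,S) = E[λ_i(X_S)·|ν_{u|i;X_S}|]`, the expectation
over `X_S` with law the marginal of `μ` on `S` (the integrand depends on the configuration only
through its restriction to `S`). -/
def avgInf {p : ℕ} (μ : (Fin p → Bool) → ℝ) (u i : Fin p) (S : Finset (Fin p)) : ℝ :=
  ∑ x : Fin p → Bool, μ x * (lamWeight μ i S x * |condInf μ u i S x|)

/-- `δ = (1/2)·e^{−2(βd+h)}`. -/
def deltaLB (β h : ℝ) (d : ℕ) : ℝ := (1/2) * Real.exp (-(2 * (β * d + h)))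

/-- `τ* = α²·δ^{4d+1}/(16dβ)`. -/
def tauStar (α β h : ℝ) (d : ℕ) : ℝ :=
  α ^ 2 * (deltaLB β h d) ^ (4 * d + 1) / (16 * d * β)

/-- The conditional mutual information `I(X_u ; X_i | X_S)`, computed with natural logarithms,
written as the expectation of the log-likelihood ratio
`log( P(X_u,X_i,X_S)·P(X_S) / (P(X_u,X_S)·P(X_i,X_S)) )`. -/
def condMI {p : ℕ} (μ : (Fin p → Bool) → ℝ) (u i : Fin p) (S : Finset (Fin p)) : ℝ :=
  ∑ x : Fin p → Bool, μ x * Real.log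
    ((prob μ (fun z => z u = x u ∧ z i = x i ∧ agree S x z) * prob μ (agree S x))
      / (prob μ (fun z => z u = x u ∧ agree S x z)
          * prob μ (fun z => z i = x i ∧ agree S x z)))

open Classical in
/-- The configurations agreeing with `σ` on `S`. -/
def agreeSet {p : ℕ} (S : Finset (Fin p)) (σ : Fin p → Bool) : Finset (Fin p → Bool) :=
  univ.filter (agree S σ)

/-- Flip the coordinate `i` of a configuration. -/
def flipAt {p : ℕ} (i : Fin p) (x : Fin p → Bool) : Fin p → Bool :=
  Function.update x i (!x i)

/-- The interaction part `∑ j, θ_{uj} x_j` of the local field at `u`. -/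
def interaction {p : ℕ} (θe : Fin p → Fin p → ℝ) (u : Fin p) (x : Fin p → Bool) : ℝ :=
  ∑ j, θe u j * spin (x j)

theorem mem_agreeSet {p : ℕ} {S : Finset (Fin p)} {σ x : Fin p → Bool} :
    x ∈ agreeSet S σ ↔ ∀ i ∈ S, x i = σ i := by
  simp [agreeSet, agree]

theorem spin_not (b : Bool) : spin (!b) = -spin b := by
  cases b <;> simp [spin]

theorem spin_sq (b : Bool) : spin b ^ 2 = 1 := by
  cases b <;> simp [spin]

theorem abs_spin (b : Bool) : |spin b| = 1 := by
  cases b <;> simp [spin]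

theorem flipAt_self {p : ℕ} (i : Fin p) (x : Fin p → Bool) : flipAt i x i = !x i := by
  simp [flipAt]

theorem flipAt_of_ne {p : ℕ} {i j : Fin p} (hij : j ≠ i) (x : Fin p → Bool) :
    flipAt i x j = x j := by
  simp [flipAt, hij]

theorem flipAt_flipAt {p : ℕ} (i : Fin p) (x : Fin p → Bool) : flipAt i (flipAt i x) = x := by
  simp [flipAt]

theorem flipAt_mem_agreeSet {p : ℕ} {S : Finset (Fin p)} {σ x : Fin p → Bool} {i : Fin p}
    (hi : i ∉ S) (hx : x ∈ agreeSet S σ) : flipAt i x ∈ agreeSet S σ := by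
  rw [mem_agreeSet] at hx ⊢
  intro j hj
  rw [flipAt_of_ne (by rintro rfl; exact hi hj), hx j hj]

theorem spin_flipAt {p : ℕ} (i j : Fin p) (x : Fin p → Bool) :
    spin (flipAt i x j) = spin (x j) - if j = i then 2 * spin (x i) else 0 := by
  by_cases hij : j = i
  · subst hij
    simp only [flipAt_self, spin_not, if_true]
    ring
  · simp [flipAt_of_ne hij, hij]

theorem sum_agreeSet_flipAt {p : ℕ} {S : Finset (Fin p)} (σ : Fin p → Bool) {i : Fin p}
    (hi : i ∉ S) (g : (Fin p → Bool) → ℝ) :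
    ∑ x ∈ agreeSet S σ, g (flipAt i x) = ∑ x ∈ agreeSet S σ, g x :=
  Finset.sum_nbij' (flipAt i) (flipAt i) (fun _ => flipAt_mem_agreeSet hi)
    (fun _ => flipAt_mem_agreeSet hi) (fun _ _ => flipAt_flipAt _ _)
    (fun _ _ => flipAt_flipAt _ _) (fun _ _ => rfl)

theorem interaction_flipAt {p : ℕ} (θe : Fin p → Fin p → ℝ) (u i : Fin p) (x : Fin p → Bool) :
    interaction θe u (flipAt i x) = interaction θe u x - 2 * (θe u i * spin (x i)) := by
  simp only [interaction, spin_flipAt, mul_sub, Finset.sum_sub_distrib, mul_ite, mul_zero,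
    Finset.sum_ite_eq', Finset.mem_univ, if_true]
  ring

theorem energy_eq {p : ℕ} (G : SimpleGraph (Fin p)) [DecidableRel G.Adj]
    {θe : Fin p → Fin p → ℝ} (θv : Fin p → ℝ)
    (hnonedge : ∀ i j, ¬ G.Adj i j → θe i j = 0) (x : Fin p → Bool) :
    energy G θe θv x
      = (∑ i, spin (x i) * interaction θe i x) / 2 + ∑ i, θv i * spin (x i) := by
  unfold energy interaction
  congr 2
  refine Finset.sum_congr rfl fun i _ => ?_
  rw [Finset.mul_sum]
  refine Finset.sum_congr rfl fun j _ => ?_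
  split_ifs with hij
  · ring
  · simp [hnonedge i j hij]

theorem energy_flipAt {p : ℕ} (G : SimpleGraph (Fin p)) [DecidableRel G.Adj]
    {θe : Fin p → Fin p → ℝ} (θv : Fin p → ℝ) (hsym : ∀ i j, θe i j = θe j i)
    (hnonedge : ∀ i j, ¬ G.Adj i j → θe i j = 0) (u : Fin p) (x : Fin p → Bool) :
    energy G θe θv (flipAt u x)
      = energy G θe θv x - 2 * spin (x u) * (interaction θe u x + θv u) := by
  have huu : θe u u = 0 := hnonedge u u G.irrefl
  have hcol : ∑ i, spin (x i) * (2 * (θe i u * spin (x u)))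
      = 2 * spin (x u) * interaction θe u x := by
    rw [interaction, Finset.mul_sum]
    refine Finset.sum_congr rfl fun i _ => ?_
    rw [hsym i u]
    ring
  simp only [energy_eq G θv hnonedge, interaction_flipAt, spin_flipAt, sub_mul, mul_sub,
    Finset.sum_sub_distrib, mul_ite, ite_mul, mul_zero, zero_mul, Finset.sum_ite_eq',
    Finset.mem_univ, if_true, hcol, huu]
  ring

theorem sum_exp_energy_pos {p : ℕ} (G : SimpleGraph (Fin p)) [DecidableRel G.Adj]
    (θe : Fin p → Fin p → ℝ) (θv : Fin p → ℝ) :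
    0 < ∑ y : Fin p → Bool, Real.exp (energy G θe θv y) :=
  Finset.sum_pos (fun _ _ => Real.exp_pos _) Finset.univ_nonempty

theorem isingPMF_pos {p : ℕ} (G : SimpleGraph (Fin p)) [DecidableRel G.Adj]
    (θe : Fin p → Fin p → ℝ) (θv : Fin p → ℝ) (x : Fin p → Bool) :
    0 < isingPMF G θe θv x :=
  div_pos (Real.exp_pos _) (sum_exp_energy_pos G θe θv)

theorem sum_isingPMF {p : ℕ} (G : SimpleGraph (Fin p)) [DecidableRel G.Adj]
    (θe : Fin p → Fin p → ℝ) (θv : Fin p → ℝ) :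
    ∑ x, isingPMF G θe θv x = 1 := by
  unfold isingPMF
  rw [← Finset.sum_div, div_self (sum_exp_energy_pos G θe θv).ne']

theorem isingPMF_flipAt {p : ℕ} (G : SimpleGraph (Fin p)) [DecidableRel G.Adj]
    {θe : Fin p → Fin p → ℝ} (θv : Fin p → ℝ) (hsym : ∀ i j, θe i j = θe j i)
    (hnonedge : ∀ i j, ¬ G.Adj i j → θe i j = 0) (u : Fin p) (x : Fin p → Bool) :
    isingPMF G θe θv (flipAt u x)
      = isingPMF G θe θv x * Real.exp (-(2 * spin (x u) * (interaction θe u x + θv u))) := by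
  unfold isingPMF
  rw [energy_flipAt G θv hsym hnonedge, sub_eq_add_neg, Real.exp_add]
  ring

theorem abs_interaction_le {p d : ℕ} (G : SimpleGraph (Fin p)) [DecidableRel G.Adj]
    {θe : Fin p → Fin p → ℝ} {β : ℝ} (hβ : 0 ≤ β) (hdeg : ∀ v, G.degree v ≤ d)
    (hedge : ∀ i j, G.Adj i j → |θe i j| ≤ β)
    (hnonedge : ∀ i j, ¬ G.Adj i j → θe i j = 0) (u : Fin p) (x : Fin p → Bool) :
    |interaction θe u x| ≤ β * d := by
  calc |interaction θe u x| ≤ ∑ j, |θe u j * spin (x j)| := Finset.abs_sum_le_sum_abs _ _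
    _ = ∑ j, |θe u j| := by simp only [abs_mul, abs_spin, mul_one]
    _ ≤ ∑ j, if j ∈ G.neighborFinset u then β else 0 := by
        refine Finset.sum_le_sum fun j _ => ?_
        split_ifs with hj
        · exact hedge u j (by simpa using hj)
        · rw [hnonedge u j (by simpa using hj), abs_zero]
    _ = G.degree u * β := by
        rw [Finset.sum_ite_mem, Finset.univ_inter, Finset.sum_const, nsmul_eq_mul,
          SimpleGraph.card_neighborFinset_eq_degree]
    _ ≤ β * d := by
        rw [mul_comm]
        exact mul_le_mul_of_nonneg_left (by exact_mod_cast hdeg u) hβ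

theorem sq_mul_exp_le {a c : ℝ} (hac : |a| ≤ c) :
    Real.exp (-c) * a ^ 2 ≤ a * (1 - Real.exp (-a)) := by
  rcases le_total 0 a with ha | ha
  · rw [abs_of_nonneg ha] at hac
    have hexp : Real.exp (-c) ≤ Real.exp (-a) := Real.exp_le_exp.2 (neg_le_neg hac)
    have hlin : a * Real.exp (-a) ≤ 1 - Real.exp (-a) := by
      have hmul : Real.exp a * Real.exp (-a) = 1 := by rw [← Real.exp_add]; simp
      nlinarith [Real.add_one_le_exp a, Real.exp_pos (-a)]
    nlinarith [mul_le_mul_of_nonneg_left hlin ha, mul_le_mul_of_nonneg_right hexp (sq_nonneg a)]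
  · have hexp : Real.exp (-c) ≤ 1 := Real.exp_le_one_iff.2 (by linarith [abs_nonneg a])
    nlinarith [Real.add_one_le_exp (-a), mul_le_mul_of_nonneg_right hexp (sq_nonneg a)]

/-- If every flip at `i` costs at most a factor `2ε` in weight, then a function whose sum over
each flip pair is bounded below by `c` has a large weighted sum. -/
theorem le_sum_of_flipAt {p : ℕ} {μ : (Fin p → Bool) → ℝ} (hμ : ∀ x, 0 < μ x)
    {S : Finset (Fin p)} (σ : Fin p → Bool) {i : Fin p} (hi : i ∉ S) {ε : ℝ} (hε : 2 * ε ≤ 1)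
    (hflip : ∀ x, 2 * ε * μ x ≤ μ (flipAt i x)) {g c : (Fin p → Bool) → ℝ}
    (hg : ∀ x, 0 ≤ g x) (hε₀ : 0 ≤ ε) (hc : ∀ x, c x ≤ g x + g (flipAt i x)) :
    ε * ∑ x ∈ agreeSet S σ, μ x * c x ≤ ∑ x ∈ agreeSet S σ, μ x * g x := by
  have hsum := sum_agreeSet_flipAt σ hi fun x => μ x * g x
  have hle : ∑ x ∈ agreeSet S σ, 2 * ε * (μ x * c x)
      ≤ ∑ x ∈ agreeSet S σ, (μ x * g x + μ (flipAt i x) * g (flipAt i x)) := by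
    refine Finset.sum_le_sum fun x _ => ?_
    have h₁ := mul_le_mul_of_nonneg_right (hflip x) (hg (flipAt i x))
    have h₂ := mul_le_mul_of_nonneg_right hε (mul_nonneg (hμ x).le (hg x))
    have h₃ := mul_le_mul_of_nonneg_left (hc x)
      (mul_nonneg (mul_nonneg two_pos.le hε₀) (hμ x).le)
    linarith
  rw [← Finset.mul_sum, Finset.sum_add_distrib, hsum] at hle
  linarith

/-- Twice the (unnormalized) covariance of `f` and `g` over the configurations agreeing with
`σ` on `S`, written as a sum over pairs. -/
def pairCov {p : ℕ} (μ : (Fin p → Bool) → ℝ) (S : Finset (Fin p)) (σ : Fin p → Bool)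
    (f g : (Fin p → Bool) → ℝ) : ℝ :=
  ∑ y ∈ agreeSet S σ, ∑ x ∈ agreeSet S σ, μ x * μ y * ((f x - f y) * (g x - g y))

theorem pairCov_eq {p : ℕ} (μ : (Fin p → Bool) → ℝ) (S : Finset (Fin p)) (σ : Fin p → Bool)
    (f g : (Fin p → Bool) → ℝ) :
    pairCov μ S σ f g = 2 * ((∑ x ∈ agreeSet S σ, μ x) * (∑ x ∈ agreeSet S σ, μ x * (f x * g x))
      - (∑ x ∈ agreeSet S σ, μ x * f x) * ∑ x ∈ agreeSet S σ, μ x * g x) := by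
  have hexpand : ∀ x y, μ x * μ y * ((f x - f y) * (g x - g y))
      = μ y * (μ x * (f x * g x)) - (μ y * g y) * (μ x * f x) - (μ y * f y) * (μ x * g x)
        + (μ y * (f y * g y)) * μ x := fun x y => by ring
  simp only [pairCov, hexpand, Finset.sum_add_distrib, Finset.sum_sub_distrib,
    ← Finset.mul_sum, ← Finset.sum_mul]
  ring

theorem prob_pos {p : ℕ} {μ : (Fin p → Bool) → ℝ} (hμ : ∀ x, 0 < μ x)
    {A : (Fin p → Bool) → Prop} {x : Fin p → Bool} (hx : A x) : 0 < prob μ A := by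
  unfold prob
  refine Finset.sum_pos' (fun y _ => ?_) ⟨x, Finset.mem_univ _, by simp [hx, hμ x]⟩
  split_ifs
  · exact (hμ y).le
  · exact le_rfl

theorem prob_agree {p : ℕ} (μ : (Fin p → Bool) → ℝ) (S : Finset (Fin p)) (σ : Fin p → Bool) :
    prob μ (agree S σ) = ∑ x ∈ agreeSet S σ, μ x := by
  simp [prob, agreeSet, Finset.sum_filter]

theorem prob_add_prob {p : ℕ} (μ : (Fin p → Bool) → ℝ) (i : Fin p)
    (A : (Fin p → Bool) → Prop) :
    prob μ (fun x => x i = true ∧ A x) + prob μ (fun x => x i = false ∧ A x) = prob μ A := by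
  unfold prob
  rw [← Finset.sum_add_distrib]
  refine Finset.sum_congr rfl fun x _ => ?_
  by_cases hx : A x <;> cases hxi : x i <;> simp [hx, hxi]

theorem sum_agreeSet_spin {p : ℕ} (μ : (Fin p → Bool) → ℝ) (S : Finset (Fin p))
    (σ : Fin p → Bool) (i : Fin p) :
    ∑ x ∈ agreeSet S σ, μ x * spin (x i)
      = prob μ (fun x => x i = true ∧ agree S σ x)
        - prob μ (fun x => x i = false ∧ agree S σ x) := by
  unfold prob agreeSet
  rw [← Finset.sum_sub_distrib, Finset.sum_filter]
  refine Finset.sum_congr rfl fun x _ => ?_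
  by_cases hx : agree S σ x <;> cases hxi : x i <;> simp [hx, hxi, spin]

theorem sum_agreeSet_spin_mul_spin {p : ℕ} (μ : (Fin p → Bool) → ℝ) (S : Finset (Fin p))
    (σ : Fin p → Bool) (u i : Fin p) :
    ∑ x ∈ agreeSet S σ, μ x * (spin (x u) * spin (x i))
      = prob μ (fun x => x u = true ∧ x i = true ∧ agree S σ x)
        - prob μ (fun x => x u = true ∧ x i = false ∧ agree S σ x)
        - prob μ (fun x => x u = false ∧ x i = true ∧ agree S σ x)
        + prob μ (fun x => x u = false ∧ x i = false ∧ agree S σ x) := by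
  unfold prob agreeSet
  rw [← Finset.sum_sub_distrib, ← Finset.sum_sub_distrib, ← Finset.sum_add_distrib,
    Finset.sum_filter]
  refine Finset.sum_congr rfl fun x _ => ?_
  by_cases hx : agree S σ x <;> cases hxi : x i <;> cases hxu : x u <;>
    simp [hx, hxi, hxu, spin]

theorem pairCov_spin {p : ℕ} {μ : (Fin p → Bool) → ℝ} (hμ : ∀ x, 0 < μ x)
    {S : Finset (Fin p)} (σ : Fin p → Bool) (u : Fin p) {i : Fin p} (hi : i ∉ S) :
    pairCov μ S σ (fun x => spin (x u)) (fun x => spin (x i))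
      = 4 * (∑ x ∈ agreeSet S σ, μ x) ^ 2 * (lamWeight μ i S σ * condInf μ u i S σ) := by
  have hpos : ∀ b, 0 < prob μ (fun x => x i = b ∧ agree S σ x) := fun b =>
    prob_pos hμ (x := Function.update σ i b) ⟨by simp, fun j hj => by
      simp [show j ≠ i from fun hji => hi (hji ▸ hj)]⟩
  have hcomm : ∀ a b, prob μ (fun x => x i = a ∧ x u = b ∧ agree S σ x)
      = prob μ (fun x => x u = b ∧ x i = a ∧ agree S σ x) := fun a b =>
    congrArg (prob μ) (funext fun x => propext and_left_comm)
  have hspin_u : ∑ x ∈ agreeSet S σ, μ x * spin (x u)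
      = prob μ (fun x => x u = true ∧ x i = true ∧ agree S σ x)
        + prob μ (fun x => x u = true ∧ x i = false ∧ agree S σ x)
        - prob μ (fun x => x u = false ∧ x i = true ∧ agree S σ x)
        - prob μ (fun x => x u = false ∧ x i = false ∧ agree S σ x) := by
    rw [sum_agreeSet_spin, ← prob_add_prob μ i (fun x => x u = true ∧ agree S σ x),
      ← prob_add_prob μ i (fun x => x u = false ∧ agree S σ x)]
    rw [hcomm, hcomm, hcomm, hcomm]
    ring
  have ht := prob_add_prob μ u fun x => x i = true ∧ agree S σ x
  have hf := prob_add_prob μ u fun x => x i = false ∧ agree S σ x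
  have hM := prob_add_prob μ i (agree S σ)
  have hMpos : 0 < prob μ (agree S σ) := prob_pos hμ (x := σ) fun _ _ => rfl
  have hpos_t := hpos true
  have hpos_f := hpos false
  rw [pairCov_eq, sum_agreeSet_spin_mul_spin, hspin_u, sum_agreeSet_spin, ← prob_agree]
  unfold lamWeight condInf condProb
  rw [← hM] at hMpos ⊢
  rw [← ht] at hpos_t hMpos ⊢
  rw [← hf] at hpos_f hMpos ⊢
  generalize prob μ (fun x => x u = true ∧ x i = true ∧ agree S σ x) = a at *
  generalize prob μ (fun x => x u = true ∧ x i = false ∧ agree S σ x) = b at *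
  generalize prob μ (fun x => x u = false ∧ x i = true ∧ agree S σ x) = c at *
  generalize prob μ (fun x => x u = false ∧ x i = false ∧ agree S σ x) = e at *
  have h₁ := hMpos.ne'
  have h₂ := hpos_t.ne'
  have h₃ := hpos_f.ne'
  field_simp
  ring

/-- Pairing a pair of configurations with the pair obtained by flipping both at `u`. -/
theorem le_pairCov_interaction {p : ℕ} {μ : (Fin p → Bool) → ℝ} (hμ : ∀ x, 0 < μ x)
    {S : Finset (Fin p)} (σ : Fin p → Bool) {u : Fin p} (hu : u ∉ S)
    {θe : Fin p → Fin p → ℝ} {t B : ℝ} (huu : θe u u = 0)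
    (hflip : ∀ x, μ (flipAt u x) = μ x * Real.exp (-(2 * spin (x u) * (interaction θe u x + t))))
    (hB : ∀ x, |interaction θe u x| ≤ B) :
    Real.exp (-(4 * B)) / 2 * ∑ y ∈ agreeSet S σ, ∑ x ∈ agreeSet S σ, μ x * μ y *
        ((spin (x u) - spin (y u)) * (interaction θe u x - interaction θe u y)) ^ 2
      ≤ pairCov μ S σ (fun x => spin (x u)) (interaction θe u) := by
  have hint : ∀ x, interaction θe u (flipAt u x) = interaction θe u x := fun x => by
    rw [interaction_flipAt, huu]; ring
  have hswap : pairCov μ S σ (fun x => spin (x u)) (interaction θe u)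
      = ∑ y ∈ agreeSet S σ, ∑ x ∈ agreeSet S σ, μ (flipAt u x) * μ (flipAt u y) *
        (-(spin (x u) - spin (y u)) * (interaction θe u x - interaction θe u y)) := by
    unfold pairCov
    rw [← sum_agreeSet_flipAt σ hu]
    refine Finset.sum_congr rfl fun y _ => ?_
    rw [← sum_agreeSet_flipAt σ hu]
    refine Finset.sum_congr rfl fun x _ => ?_
    simp only [hint, flipAt_self, spin_not]
    ring
  have hpair : ∀ x y, Real.exp (-(4 * B)) * (μ x * μ y *
        ((spin (x u) - spin (y u)) * (interaction θe u x - interaction θe u y)) ^ 2)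
      ≤ μ x * μ y * ((spin (x u) - spin (y u)) * (interaction θe u x - interaction θe u y))
        + μ (flipAt u x) * μ (flipAt u y) *
        (-(spin (x u) - spin (y u)) * (interaction θe u x - interaction θe u y)) := by
    intro x y
    have hxB := abs_le.1 (hB x)
    have hyB := abs_le.1 (hB y)
    set z := interaction θe u x - interaction θe u y with hz
    by_cases hxy : x u = y u
    · simp [hxy]
    · have hy : spin (y u) = -spin (x u) := by
        rw [← spin_not]; congr 1; revert hxy; cases x u <;> cases y u <;> simp
      set a := (spin (x u) - spin (y u)) * z with ha
      have hexp : μ (flipAt u x) * μ (flipAt u y) = μ x * μ y * Real.exp (-a) := by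
        rw [hflip, hflip, mul_mul_mul_comm, ← Real.exp_add, ha, hz, hy]
        congr 2
        ring
      have habs : |a| ≤ 4 * B := by
        rw [ha, hy, sub_neg_eq_add, ← two_mul, abs_mul, abs_mul, abs_spin]
        have : |z| ≤ 2 * B := abs_le.2 ⟨by linarith, by linarith⟩
        norm_num
        linarith
      have := mul_le_mul_of_nonneg_left (sq_mul_exp_le habs) (mul_pos (hμ x) (hμ y)).le
      rw [hexp, neg_mul, ← ha]
      linarith
  have hsum := Finset.sum_le_sum fun y (_ : y ∈ agreeSet S σ) =>
    Finset.sum_le_sum fun x (_ : x ∈ agreeSet S σ) => hpair x y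
  simp only [Finset.sum_add_distrib, ← Finset.mul_sum] at hsum
  rw [← hswap] at hsum
  unfold pairCov at hsum ⊢
  linarith

theorem le_sum_sq_interaction {p : ℕ} {μ : (Fin p → Bool) → ℝ} (hμ : ∀ x, 0 < μ x)
    {S : Finset (Fin p)} (σ : Fin p → Bool) {u i : Fin p} (hu : u ∉ S) (hi : i ∉ S)
    (hui : u ≠ i) {θe : Fin p → Fin p → ℝ} {α ε : ℝ} (hα : 0 ≤ α) (hθ : α ≤ |θe u i|)
    (hε₀ : 0 ≤ ε) (hε : 2 * ε ≤ 1) (hflip : ∀ j x, 2 * ε * μ x ≤ μ (flipAt j x)) :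
    8 * α ^ 2 * ε ^ 2 * (∑ x ∈ agreeSet S σ, μ x) ^ 2
      ≤ ∑ y ∈ agreeSet S σ, ∑ x ∈ agreeSet S σ, μ x * μ y *
        ((spin (x u) - spin (y u)) * (interaction θe u x - interaction θe u y)) ^ 2 := by
  have hθsq : α ^ 2 ≤ θe u i ^ 2 := by
    rw [← sq_abs (θe u i)]
    exact pow_le_pow_left₀ hα hθ 2
  have hrow : ∀ y, 8 * α ^ 2 * ε ^ 2 * ∑ x ∈ agreeSet S σ, μ x
      ≤ ∑ x ∈ agreeSet S σ, μ x *
        ((spin (x u) - spin (y u)) * (interaction θe u x - interaction θe u y)) ^ 2 := by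
    intro y
    have h_i := le_sum_of_flipAt hμ σ hi hε (hflip i)
      (g := fun x => ((spin (x u) - spin (y u))
        * (interaction θe u x - interaction θe u y)) ^ 2)
      (c := fun x => (spin (x u) - spin (y u)) ^ 2 * (2 * α ^ 2))
      (fun x => sq_nonneg _) hε₀ (fun x => by
        simp only [interaction_flipAt, flipAt_of_ne hui, mul_pow, ← mul_add]
        refine mul_le_mul_of_nonneg_left ?_ (sq_nonneg _)
        have hsq : (θe u i * spin (x i)) ^ 2 = θe u i ^ 2 := by rw [mul_pow, spin_sq, mul_one]
        nlinarith [sq_nonneg (interaction θe u x - interaction θe u y - θe u i * spin (x i))])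
    have h_u := le_sum_of_flipAt hμ σ hu hε (hflip u)
      (g := fun x => (spin (x u) - spin (y u)) ^ 2) (c := fun _ => 4)
      (fun x => sq_nonneg _) hε₀ (fun x => by
        simp only [flipAt_self, spin_not]
        nlinarith [spin_sq (x u), spin_sq (y u)])
    simp only [← mul_assoc, ← Finset.sum_mul] at h_i h_u
    have := mul_le_mul_of_nonneg_left h_u
      (mul_nonneg hε₀ (mul_nonneg two_pos.le (sq_nonneg α)))
    simp only [mul_assoc] at *
    linarith
  calc 8 * α ^ 2 * ε ^ 2 * (∑ x ∈ agreeSet S σ, μ x) ^ 2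
      = ∑ y ∈ agreeSet S σ, μ y * (8 * α ^ 2 * ε ^ 2 * ∑ x ∈ agreeSet S σ, μ x) := by
        rw [← Finset.sum_mul]; ring
    _ ≤ ∑ y ∈ agreeSet S σ, μ y * ∑ x ∈ agreeSet S σ, μ x *
        ((spin (x u) - spin (y u)) * (interaction θe u x - interaction θe u y)) ^ 2 :=
        Finset.sum_le_sum fun y _ => mul_le_mul_of_nonneg_left (hrow y) (hμ y).le
    _ = _ := by
        refine Finset.sum_congr rfl fun y _ => ?_
        rw [Finset.mul_sum]
        exact Finset.sum_congr rfl fun x _ => by ring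

theorem pairCov_interaction {p : ℕ} (μ : (Fin p → Bool) → ℝ) (S : Finset (Fin p))
    (σ : Fin p → Bool) (θe : Fin p → Fin p → ℝ) (u : Fin p) (f : (Fin p → Bool) → ℝ) :
    pairCov μ S σ f (interaction θe u)
      = ∑ j, θe u j * pairCov μ S σ f (fun x => spin (x j)) := by
  unfold pairCov interaction
  simp only [Finset.mul_sum]
  symm
  rw [Finset.sum_comm]
  refine Finset.sum_congr rfl fun y _ => ?_
  rw [Finset.sum_comm]
  refine Finset.sum_congr rfl fun x _ => ?_
  rw [← Finset.sum_sub_distrib, Finset.mul_sum, Finset.mul_sum]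
  exact Finset.sum_congr rfl fun j _ => by ring

theorem pairCov_spin_of_mem {p : ℕ} (μ : (Fin p → Bool) → ℝ) {S : Finset (Fin p)}
    (σ : Fin p → Bool) (f : (Fin p → Bool) → ℝ) {j : Fin p} (hj : j ∈ S) :
    pairCov μ S σ f (fun x => spin (x j)) = 0 := by
  refine Finset.sum_eq_zero fun y hy => Finset.sum_eq_zero fun x hx => ?_
  rw [mem_agreeSet] at hx hy
  simp [hx j hj, hy j hj]

theorem lamWeight_nonneg {p : ℕ} {μ : (Fin p → Bool) → ℝ} (hμ : ∀ x, 0 ≤ μ x) (i : Fin p)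
    (S : Finset (Fin p)) (σ : Fin p → Bool) : 0 ≤ lamWeight μ i S σ := by
  have hprob : ∀ A, 0 ≤ prob μ A := fun A => by
    refine Finset.sum_nonneg fun x _ => ?_
    split_ifs
    · exact hμ x
    · exact le_rfl
  exact mul_nonneg (mul_nonneg two_pos.le (div_nonneg (hprob _) (hprob _)))
    (div_nonneg (hprob _) (hprob _))

/-- The pointwise bound: given `X_S = σ_S`, the total weighted influence on `u` of its
neighbors outside `S` is bounded below. -/
theorem le_sum_lamWeight_mul_abs_condInf {p d : ℕ} (G : SimpleGraph (Fin p))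
    [DecidableRel G.Adj] (θe : Fin p → Fin p → ℝ) (θv : Fin p → ℝ) {α β h : ℝ}
    (hα : 0 < α) (hαβ : α ≤ β) (hh : 0 ≤ h) (hdeg : ∀ v, G.degree v ≤ d)
    (hsym : ∀ i j, θe i j = θe j i)
    (hedge : ∀ i j, G.Adj i j → α ≤ |θe i j| ∧ |θe i j| ≤ β)
    (hnonedge : ∀ i j, ¬ G.Adj i j → θe i j = 0) (hfield : ∀ i, |θv i| ≤ h)
    {u i : Fin p} {S : Finset (Fin p)} (hu : u ∉ S) (hi : i ∈ G.neighborFinset u \ S)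
    (σ : Fin p → Bool) :
    4 * α ^ 2 * deltaLB β h d ^ 4
      ≤ β * ∑ j ∈ G.neighborFinset u \ S,
        lamWeight (isingPMF G θe θv) j S σ * |condInf (isingPMF G θe θv) u j S σ| := by
  have hβ : 0 < β := hα.trans_le hαβ
  obtain ⟨hadj, hiS⟩ := Finset.mem_sdiff.1 hi
  rw [SimpleGraph.mem_neighborFinset] at hadj
  set ε := deltaLB β h d with hε
  have hε₂ : 2 * ε = Real.exp (-(2 * (β * d + h))) := by rw [hε, deltaLB]; ring
  have hε₀ : 0 < ε := by have := Real.exp_pos (-(2 * (β * d + h))); linarith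
  have hβd : 0 ≤ β * d := by positivity
  have hε₁ : 2 * ε ≤ 1 := hε₂ ▸ Real.exp_le_one_iff.2 (by linarith)
  have hμ := isingPMF_pos G θe θv
  have hflipEq := isingPMF_flipAt G θv hsym hnonedge
  have hint := abs_interaction_le G hβ.le hdeg (fun i j hij => (hedge i j hij).2) hnonedge
  set μ := isingPMF G θe θv
  have hflip : ∀ j x, 2 * ε * μ x ≤ μ (flipAt j x) := by
    intro j x
    rw [hflipEq, hε₂, mul_comm]
    refine mul_le_mul_of_nonneg_left (Real.exp_le_exp.2 (neg_le_neg ?_)) (hμ x).le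
    calc 2 * spin (x j) * (interaction θe j x + θv j)
        ≤ |2 * spin (x j) * (interaction θe j x + θv j)| := le_abs_self _
      _ = 2 * |interaction θe j x + θv j| := by rw [abs_mul, abs_mul, abs_spin]; norm_num
      _ ≤ 2 * (β * d + h) := by
        have := abs_add_le (interaction θe j x) (θv j)
        linarith [hint j x, hfield j]
  have hexp : 4 * ε ^ 2 ≤ Real.exp (-(4 * (β * d))) := by
    rw [show 4 * ε ^ 2 = (2 * ε) ^ 2 by ring, hε₂, ← Real.exp_nat_mul]
    exact Real.exp_le_exp.2 (by push_cast; linarith)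
  have hM : 0 < ∑ x ∈ agreeSet S σ, μ x :=
    Finset.sum_pos (fun x _ => hμ x) ⟨σ, mem_agreeSet.2 fun _ _ => rfl⟩
  have hcov := le_pairCov_interaction hμ σ hu (hnonedge u u G.irrefl) (hflipEq u) (hint u)
  have hvar := le_sum_sq_interaction hμ σ hu hiS hadj.ne hα.le (hedge u i hadj).1 hε₀.le hε₁
    hflip
  have hupper : pairCov μ S σ (fun x => spin (x u)) (interaction θe u)
      ≤ 4 * (∑ x ∈ agreeSet S σ, μ x) ^ 2 * (β * ∑ j ∈ G.neighborFinset u \ S,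
        lamWeight μ j S σ * |condInf μ u j S σ|) := by
    have hsupp : pairCov μ S σ (fun x => spin (x u)) (interaction θe u)
        = ∑ j ∈ G.neighborFinset u \ S,
          θe u j * pairCov μ S σ (fun x => spin (x u)) (fun x => spin (x j)) := by
      rw [pairCov_interaction]
      refine (Finset.sum_subset (Finset.subset_univ _) fun j _ hj => ?_).symm
      by_cases hjS : j ∈ S
      · rw [pairCov_spin_of_mem μ σ _ hjS, mul_zero]
      · rw [hnonedge u j fun hadj => hj (by simp [hadj, hjS]), zero_mul]
    rw [hsupp, Finset.mul_sum, Finset.mul_sum]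
    refine Finset.sum_le_sum fun j hj => ?_
    obtain ⟨hju, hjS⟩ := Finset.mem_sdiff.1 hj
    rw [pairCov_spin hμ σ u hjS, mul_left_comm]
    refine mul_le_mul_of_nonneg_left ?_ (by positivity)
    rw [mul_left_comm, mul_left_comm β]
    refine mul_le_mul_of_nonneg_left ?_ (lamWeight_nonneg (fun x => (hμ x).le) j S σ)
    calc θe u j * condInf μ u j S σ ≤ |θe u j| * |condInf μ u j S σ| := by
          rw [← abs_mul]; exact le_abs_self _
      _ ≤ β * |condInf μ u j S σ| := mul_le_mul_of_nonneg_right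
          (hedge u j (by simpa using hju)).2 (abs_nonneg _)
  refine le_of_mul_le_mul_left ?_ (show 0 < 4 * (∑ x ∈ agreeSet S σ, μ x) ^ 2 by positivity)
  refine le_trans ?_ (hcov.trans hupper)
  calc 4 * (∑ x ∈ agreeSet S σ, μ x) ^ 2 * (4 * α ^ 2 * ε ^ 4)
      = 4 * ε ^ 2 / 2 * (8 * α ^ 2 * ε ^ 2 * (∑ x ∈ agreeSet S σ, μ x) ^ 2) := by ring
    _ ≤ _ := mul_le_mul (by linarith) hvar (by positivity) (by positivity)

/-- structural property — some neighbor outside `S` has average conditional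
influence at least `2τ*`. -/
theorem stmt4
    {p d : ℕ} (G : SimpleGraph (Fin p)) [DecidableRel G.Adj]
    (θe : Fin p → Fin p → ℝ) (θv : Fin p → ℝ) (α β h : ℝ)
    (hα : 0 < α) (hαβ : α ≤ β) (hh : 0 ≤ h)
    (hdeg : ∀ v, G.degree v ≤ d)
    (hsym : ∀ i j, θe i j = θe j i)
    (hedge : ∀ i j, G.Adj i j → α ≤ |θe i j| ∧ |θe i j| ≤ β)
    (hnonedge : ∀ i j, ¬ G.Adj i j → θe i j = 0)
    (hfield : ∀ i, |θv i| ≤ h)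
    (u : Fin p) (S : Finset (Fin p)) (huS : u ∉ S)
    (hnb : ¬ G.neighborFinset u ⊆ S) :
    ∃ i ∈ G.neighborFinset u \ S,
      avgInf (isingPMF G θe θv) u i S ≥ 2 * tauStar α β h d := by
  obtain ⟨i, hiu, hiS⟩ := Finset.not_subset.1 hnb
  have hi : i ∈ G.neighborFinset u \ S := Finset.mem_sdiff.2 ⟨hiu, hiS⟩
  have hβ : 0 < β := hα.trans_le hαβ
  have hcard : (G.neighborFinset u \ S).card ≤ d :=
    (Finset.card_le_card Finset.sdiff_subset).trans
      ((G.card_neighborFinset_eq_degree u).trans_le (hdeg u))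
  have hd : 1 ≤ d := (Finset.card_pos.2 ⟨i, hi⟩).trans_le hcard
  have hd' : (0 : ℝ) < d := by exact_mod_cast hd
  have hδ₀ : 0 < deltaLB β h d := by unfold deltaLB; positivity
  have hδ₁ : deltaLB β h d ≤ 1 := by
    have : Real.exp (-(2 * (β * d + h))) ≤ 1 :=
      Real.exp_le_one_iff.2 (by have := mul_pos hβ hd'; linarith)
    unfold deltaLB
    linarith
  have htotal : 4 * α ^ 2 * deltaLB β h d ^ 4
      ≤ β * ∑ j ∈ G.neighborFinset u \ S, avgInf (isingPMF G θe θv) u j S := by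
    calc 4 * α ^ 2 * deltaLB β h d ^ 4
        = ∑ x, isingPMF G θe θv x * (4 * α ^ 2 * deltaLB β h d ^ 4) := by
          rw [← Finset.sum_mul, sum_isingPMF, one_mul]
      _ ≤ ∑ x, isingPMF G θe θv x * (β * ∑ j ∈ G.neighborFinset u \ S,
            lamWeight (isingPMF G θe θv) j S x * |condInf (isingPMF G θe θv) u j S x|) :=
          Finset.sum_le_sum fun x _ => mul_le_mul_of_nonneg_left
            (le_sum_lamWeight_mul_abs_condInf G θe θv hα hαβ hh hdeg hsym hedge hnonedge hfield
              huS hi x) (isingPMF_pos G θe θv x).le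
      _ = β * ∑ j ∈ G.neighborFinset u \ S, avgInf (isingPMF G θe θv) u j S := by
          unfold avgInf
          rw [Finset.sum_comm, Finset.mul_sum]
          refine Finset.sum_congr rfl fun x _ => ?_
          rw [← Finset.mul_sum]
          ring
  by_contra! hlt
  have hτ : 0 < tauStar α β h d := by unfold tauStar; positivity
  have hsum : ∑ j ∈ G.neighborFinset u \ S, avgInf (isingPMF G θe θv) u j S
      < d * (2 * tauStar α β h d) := by
    calc ∑ j ∈ G.neighborFinset u \ S, avgInf (isingPMF G θe θv) u j S
        < ∑ _j ∈ G.neighborFinset u \ S, 2 * tauStar α β h d :=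
          Finset.sum_lt_sum_of_nonempty ⟨i, hi⟩ hlt
      _ ≤ d * (2 * tauStar α β h d) := by
          rw [Finset.sum_const, nsmul_eq_mul]
          exact mul_le_mul_of_nonneg_right (by exact_mod_cast hcard) (by positivity)
  have hbound := htotal.trans_lt (mul_lt_mul_of_pos_left hsum hβ)
  have hτeq : β * (d * (2 * tauStar α β h d)) = α ^ 2 * deltaLB β h d ^ (4 * d + 1) / 8 := by
    unfold tauStar
    field_simp
    ring
  have hpow : α ^ 2 * deltaLB β h d ^ (4 * d + 1) ≤ α ^ 2 * deltaLB β h d ^ 4 :=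
    mul_le_mul_of_nonneg_left (pow_le_pow_of_le_one hδ₀.le hδ₁ (by omega)) (sq_nonneg α)
  have hpos : 0 < α ^ 2 * deltaLB β h d ^ 4 := by positivity
  rw [hτeq] at hbound
  linarith
end
end

section
/- Let u ∈ V, let S ⊆ V∖{u}, let U := ∂u∖S be nonempty, and fix x_S ∈ {−1,+1}^S with P(X_S = x_S) > 0. Let Y be a random vector in {−1,+1}^U distributed as the conditional law of X_U given X_S = x_S and let g(y) := P(X_u = +1 | X_U = y, X_S = x_S). Then Σ_{i∈U} θ_{ui}·λ_i(x_S)·ν_{u|i;x_S} = (1/2)·E[ (2g(Y) − 1)·( Σ_{i∈U} θ_{ui} Y_i − E[Σ_{i∈U} θ_{ui} Y_i] ) ]. -/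
noncomputable section

open Real Finset

theorem isingPMF_nonneg {p : ℕ} (G : SimpleGraph (Fin p)) [DecidableRel G.Adj]
    (θe : Fin p → Fin p → ℝ) (θv : Fin p → ℝ) (x : Fin p → Bool) : 0 ≤ isingPMF G θe θv x := by
  unfold isingPMF
  positivity

section FiniteLaw

variable {p : ℕ} {μ : (Fin p → Bool) → ℝ}

theorem prob_nonneg (hμ : ∀ x, 0 ≤ μ x) (A : (Fin p → Bool) → Prop) : 0 ≤ prob μ A :=
  Finset.sum_nonneg fun x _ => by split_ifs <;> simp [hμ x]

theorem prob_mono (hμ : ∀ x, 0 ≤ μ x) {A B : (Fin p → Bool) → Prop} (hAB : ∀ x, A x → B x) :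
    prob μ A ≤ prob μ B := by
  refine Finset.sum_le_sum fun x _ => ?_
  by_cases hA : A x
  · simp [hA, hAB x hA]
  · simp only [hA, if_false]
    split_ifs <;> simp [hμ x]

theorem le_prob (hμ : ∀ x, 0 ≤ μ x) {A : (Fin p → Bool) → Prop} {x : Fin p → Bool} (hx : A x) :
    μ x ≤ prob μ A := by
  classical
  have h := Finset.single_le_sum (f := fun y => if A y then μ y else 0)
    (fun y _ => by split_ifs <;> simp [hμ y]) (Finset.mem_univ x)
  simp only [hx, if_true] at h
  exact h.trans (le_of_eq (Finset.sum_congr rfl fun y _ => by congr))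

theorem condExp_sub (B : (Fin p → Bool) → Prop) (f g : (Fin p → Bool) → ℝ) :
    condExp μ B (fun x => f x - g x) = condExp μ B f - condExp μ B g := by
  unfold condExp
  rw [← sub_div, ← Finset.sum_sub_distrib]
  congr 1
  refine Finset.sum_congr rfl fun x _ => ?_
  split_ifs <;> ring

theorem condExp_const_mul (B : (Fin p → Bool) → Prop) (c : ℝ) (f : (Fin p → Bool) → ℝ) :
    condExp μ B (fun x => c * f x) = c * condExp μ B f := by
  unfold condExp
  rw [← mul_div_assoc, Finset.mul_sum]
  congr 1
  refine Finset.sum_congr rfl fun x _ => ?_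
  split_ifs <;> ring

theorem condExp_sum {ι : Type*} (B : (Fin p → Bool) → Prop) (s : Finset ι)
    (f : ι → (Fin p → Bool) → ℝ) :
    condExp μ B (fun x => ∑ i ∈ s, f i x) = ∑ i ∈ s, condExp μ B (f i) := by
  unfold condExp
  rw [← Finset.sum_div, Finset.sum_comm]
  congr 1
  refine Finset.sum_congr rfl fun x _ => ?_
  split_ifs <;> simp [Finset.mul_sum]

theorem condExp_one {B : (Fin p → Bool) → Prop} (hB : prob μ B ≠ 0) :
    condExp μ B (fun _ => 1) = 1 := by
  simp only [condExp, mul_one]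
  exact div_self hB

theorem condExp_indicator (A B : (Fin p → Bool) → Prop) [DecidablePred A] :
    condExp μ B (fun x => if A x then 1 else 0) = condProb μ A B := by
  unfold condExp condProb prob
  congr 1
  refine Finset.sum_congr rfl fun x _ => ?_
  by_cases hA : A x <;> by_cases hB : B x <;> simp [hA, hB]

theorem prob_eq_add (A : (Fin p → Bool) → Prop) (i : Fin p) :
    prob μ A = prob μ (fun x => x i = true ∧ A x) + prob μ (fun x => x i = false ∧ A x) := by
  unfold prob
  rw [← Finset.sum_add_distrib]
  refine Finset.sum_congr rfl fun x _ => ?_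
  by_cases hA : A x <;> cases h : x i <;> simp [hA, h]

theorem condExp_spin (B : (Fin p → Bool) → Prop) (i : Fin p) :
    condExp μ B (fun x => spin (x i)) =
      (prob μ (fun x => x i = true ∧ B x) - prob μ (fun x => x i = false ∧ B x)) / prob μ B := by
  unfold condExp prob
  rw [← Finset.sum_sub_distrib]
  congr 1
  refine Finset.sum_congr rfl fun x _ => ?_
  by_cases hB : B x <;> cases h : x i <;> simp [hB, h, spin]

theorem agree_comm {U : Finset (Fin p)} {x z : Fin p → Bool} : agree U x z ↔ agree U z x :=
  ⟨fun h i hi => (h i hi).symm, fun h i hi => (h i hi).symm⟩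

theorem prob_agree_congr {U : Finset (Fin p)} (B : (Fin p → Bool) → Prop) {x z : Fin p → Bool}
    (hxz : agree U x z) :
    prob μ (fun y => agree U x y ∧ B y) = prob μ (fun y => agree U z y ∧ B y) := by
  have h : ∀ y, agree U x y ↔ agree U z y := fun y =>
    forall₂_congr fun i hi => by rw [hxz i hi]
  simp only [h]

/-- The tower property for conditioning on the coordinates in `U`. -/
theorem condExp_condProb_agree_mul (hμ : ∀ x, 0 ≤ μ x) (U : Finset (Fin p))
    (A B : (Fin p → Bool) → Prop) [DecidablePred A] (f : (Fin p → Bool) → ℝ)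
    (hf : ∀ x z, agree U x z → f x = f z) :
    condExp μ B (fun x => condProb μ A (fun z => agree U x z ∧ B z) * f x) =
      condExp μ B (fun x => (if A x then 1 else 0) * f x) := by
  classical
  set D : (Fin p → Bool) → ℝ := fun x => prob μ (fun y => agree U x y ∧ B y) with hD
  have hleft : ∀ x, (if B x then μ x * (condProb μ A (fun z => agree U x z ∧ B z) * f x) else 0)
      = ∑ z, if A z ∧ B z ∧ B x ∧ agree U z x then μ x * (μ z * f z / D z) else 0 := by
    intro x
    by_cases hB : B x
    · simp only [hB, if_true, true_and]
      rw [condProb, prob, div_mul_eq_mul_div, Finset.sum_mul, Finset.sum_div, Finset.mul_sum]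
      refine Finset.sum_congr rfl fun z _ => ?_
      by_cases hxz : agree U x z
      · have hDD : D x = D z := prob_agree_congr B hxz
        have hzx := agree_comm.1 hxz
        change μ x * (_ / D x) = _
        rw [hDD, hf x z hxz]
        by_cases hA : A z <;> by_cases hB' : B z <;> simp [hA, hB', hxz, hzx]
      · have hzx : ¬ agree U z x := fun h => hxz (agree_comm.1 h)
        simp [hxz, hzx]
    · simp [hB]
  unfold condExp
  congr 1
  rw [Finset.sum_congr rfl fun x _ => hleft x, Finset.sum_comm]
  refine Finset.sum_congr rfl fun z _ => ?_
  by_cases hA : A z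
  · by_cases hB : B z
    · have hsum : (∑ x, if agree U z x ∧ B x then μ x else 0) = D z :=
        Finset.sum_congr rfl fun _ _ => by congr
      have hle : μ z ≤ D z := le_prob hμ ⟨fun _ _ => rfl, hB⟩
      calc _ = (∑ x, if agree U z x ∧ B x then μ x else 0) * (μ z * f z / D z) := by
            rw [Finset.sum_mul]
            refine Finset.sum_congr rfl fun x _ => ?_
            by_cases h1 : B x <;> by_cases h2 : agree U z x <;> simp [hA, hB, h1, h2]
        _ = _ := by
            rw [hsum]
            simp only [hA, hB, if_true, one_mul]
            rcases eq_or_ne (D z) 0 with h0 | h0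
            · have : μ z = 0 := le_antisymm (h0 ▸ hle) (hμ z)
              simp [this]
            · field_simp
    · simp [hB]
  · simp [hA]

/-- The weighted influence is the conditional covariance of the indicator of `X_u = +1` and the
spin `X_i`. -/
theorem lamWeight_mul_condInf (hμ : ∀ x, 0 ≤ μ x) (u i : Fin p) (S : Finset (Fin p))
    (σ : Fin p → Bool) (hS : prob μ (agree S σ) ≠ 0) :
    lamWeight μ i S σ * condInf μ u i S σ =
      condExp μ (agree S σ) (fun x => (if x u = true then 1 else 0) * spin (x i))
        - condExp μ (agree S σ) (fun x => if x u = true then 1 else 0)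
          * condExp μ (agree S σ) (fun x => spin (x i)) := by
  have hcov : condExp μ (agree S σ) (fun x => (if x u = true then 1 else 0) * spin (x i)) =
      (prob μ (fun x => x u = true ∧ x i = true ∧ agree S σ x)
        - prob μ (fun x => x u = true ∧ x i = false ∧ agree S σ x)) / prob μ (agree S σ) := by
    unfold condExp prob
    rw [← Finset.sum_sub_distrib]
    congr 1
    refine Finset.sum_congr rfl fun x _ => ?_
    by_cases hB : agree S σ x <;> cases h : x i <;> cases h' : x u <;> simp [hB, h, h', spin]
  have hr := prob_eq_add (μ := μ) (fun x => x u = true ∧ agree S σ x) i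
  simp only [and_left_comm (a := _ = true) (b := (_ : Fin p → Bool) u = true),
    and_left_comm (a := _ = false) (b := (_ : Fin p → Bool) u = true)] at hr
  have hq := prob_eq_add (μ := μ) (agree S σ) i
  have hzero : ∀ b, prob μ (fun x => x i = b ∧ agree S σ x) = 0 →
      prob μ (fun x => x u = true ∧ x i = b ∧ agree S σ x) = 0 := fun b hb =>
    le_antisymm (hb ▸ prob_mono hμ fun _ h => h.2) (prob_nonneg hμ _)
  have h1 := hzero true
  have h0 := hzero false
  rw [hcov, condExp_indicator, condExp_spin, lamWeight, condInf]
  unfold condProb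
  rw [hr]
  generalize prob μ (fun x => x u = true ∧ x i = true ∧ agree S σ x) = r1 at *
  generalize prob μ (fun x => x u = true ∧ x i = false ∧ agree S σ x) = r0 at *
  generalize prob μ (fun x => x i = true ∧ agree S σ x) = q1 at *
  generalize prob μ (fun x => x i = false ∧ agree S σ x) = q0 at *
  generalize prob μ (agree S σ) = Z at *
  have e1 : q1 * (r1 / q1) = r1 := by
    rcases eq_or_ne q1 0 with h | h
    · simp [h, h1 h]
    · field_simp
  have e0 : q0 * (r0 / q0) = r0 := by
    rcases eq_or_ne q0 0 with h | h
    · simp [h, h0 h]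
    · field_simp
  generalize r1 / q1 = t1 at *
  generalize r0 / q0 = t0 at *
  field_simp
  rw [hq, ← e1, ← e0]
  ring

end FiniteLaw

/-- the sum of signed weighted influences equals
`(1/2)·E[(2g(Y)−1)(Σ θ_{ui} Y_i − E Σ θ_{ui} Y_i)]`. -/
theorem stmt7
    {p d : ℕ} (G : SimpleGraph (Fin p)) [DecidableRel G.Adj]
    (θe : Fin p → Fin p → ℝ) (θv : Fin p → ℝ) (α β h : ℝ)
    (hα : 0 < α) (hαβ : α ≤ β) (hh : 0 ≤ h)
    (hdeg : ∀ v, G.degree v ≤ d)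
    (hsym : ∀ i j, θe i j = θe j i)
    (hedge : ∀ i j, G.Adj i j → α ≤ |θe i j| ∧ |θe i j| ≤ β)
    (hnonedge : ∀ i j, ¬ G.Adj i j → θe i j = 0)
    (hfield : ∀ i, |θv i| ≤ h)
    (u : Fin p) (S : Finset (Fin p)) (huS : u ∉ S)
    (hU : (G.neighborFinset u \ S).Nonempty)
    (σ : Fin p → Bool)
    (hpos : 0 < prob (isingPMF G θe θv) (agree S σ)) :
    ∑ i ∈ G.neighborFinset u \ S,
        θe u i * (lamWeight (isingPMF G θe θv) i S σ * condInf (isingPMF G θe θv) u i S σ)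
      = (1/2) * condExp (isingPMF G θe θv) (agree S σ) (fun x =>
          (2 * condProb (isingPMF G θe θv) (fun z => z u = true)
              (fun z => agree (G.neighborFinset u \ S) x z ∧ agree S σ z) - 1)
          * ((∑ i ∈ G.neighborFinset u \ S, θe u i * spin (x i))
              - condExp (isingPMF G θe θv) (agree S σ)
                  (fun y => ∑ i ∈ G.neighborFinset u \ S, θe u i * spin (y i)))) := by
  classical
  have hμ := isingPMF_nonneg G θe θv
  generalize isingPMF G θe θv = μ at *
  have hZ := hpos.ne'
  generalize G.neighborFinset u \ S = U
  set B := agree S σ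
  set L : (Fin p → Bool) → ℝ := fun x => ∑ i ∈ U, θe u i * spin (x i) with hL
  set m := condExp μ B L with hm
  have hcentered : condExp μ B (fun x => L x - m) = 0 := by
    have h := condExp_const_mul (μ := μ) B m (fun _ => 1)
    rw [condExp_one hZ] at h
    simp only [mul_one] at h
    rw [condExp_sub, h, ← hm, sub_self]
  have hexp : ∀ x, (2 * condProb μ (fun z => z u = true) (fun z => agree U x z ∧ B z) - 1)
      * (L x - m) = 2 * (condProb μ (fun z => z u = true) (fun z => agree U x z ∧ B z)
        * (L x - m)) - (L x - m) := fun x => by ring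
  have hLU : ∀ x z, agree U x z → L x - m = L z - m := fun x z hxz => by
    rw [hL]
    congr 1
    exact Finset.sum_congr rfl fun i hi => by rw [hxz i hi]
  change _ = 1 / 2 * condExp μ B (fun x => (2 * condProb μ (fun z => z u = true)
    (fun z => agree U x z ∧ B z) - 1) * (L x - m))
  simp only [hexp]
  rw [condExp_sub, condExp_const_mul, hcentered,
    condExp_condProb_agree_mul hμ U (fun z => z u = true) B (fun x => L x - m) hLU]
  have hlin : ∀ x : Fin p → Bool, (if x u = true then (1 : ℝ) else 0) * (L x - m) =
      (∑ i ∈ U, θe u i * ((if x u = true then 1 else 0) * spin (x i)))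
        - m * (if x u = true then 1 else 0) := fun x => by
    rw [mul_sub, hL, Finset.mul_sum, mul_comm m]
    congr 1
    exact Finset.sum_congr rfl fun i _ => by ring
  simp only [hlin]
  rw [condExp_sub, condExp_sum, condExp_const_mul, hm, hL, condExp_sum]
  rw [Finset.sum_mul, ← Finset.sum_sub_distrib, sub_zero, ← mul_assoc]
  rw [one_div, inv_mul_cancel₀ two_ne_zero, one_mul]
  refine Finset.sum_congr rfl fun i _ => ?_
  rw [lamWeight_mul_condInf hμ u i S σ hZ, condExp_const_mul B (θe u i) fun x => spin (x i),
    condExp_const_mul B (θe u i) fun x => (if x u = true then 1 else 0) * spin (x i)]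
  ring
end
end

section
/- (Erdős, Littlewood–Offord.) Let w_1, …, w_r be real numbers with |w_i| ≥ α > 0 for all i, and let I = (t_0 − α, t_0 + α) be an open interval of length 2α. If ξ = (ξ_1, …, ξ_r) is uniformly distributed on {−1,+1}^r, then P( Σ_{i=1}^r w_i ξ_i ∈ I ) ≤ 2^{−r}·C(r, ⌊r/2⌋) ≤ 1/2, where C(r,k) denotes the binomial coefficient. -/
noncomputable section

open Real Finset

/-- The indices at which the sign `spin (y i)` agrees with the sign of `w i`. -/
def alignedSet {ι : Type*} [Fintype ι] (w : ι → ℝ) (y : ι → Bool) : Finset ι :=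
  univ.filter fun i => y i = decide (0 < w i)

theorem mem_alignedSet {ι : Type*} [Fintype ι] {w : ι → ℝ} {y : ι → Bool} {i : ι} :
    i ∈ alignedSet w y ↔ y i = decide (0 < w i) := by
  simp [alignedSet]

theorem alignedSet_injective {ι : Type*} [Fintype ι] (w : ι → ℝ) :
    Function.Injective (alignedSet w) := by
  intro y z h
  funext i
  have hi := Finset.ext_iff.1 h i
  rw [mem_alignedSet, mem_alignedSet] at hi
  cases hy : y i <;> cases hz : z i <;> cases hd : decide (0 < w i) <;> simp [hy, hz, hd] at hi ⊢

open Classical in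
theorem mul_spin_eq_ite {ι : Type*} [Fintype ι] (w : ι → ℝ) (y : ι → Bool) (i : ι) :
    w i * spin (y i) = if i ∈ alignedSet w y then |w i| else -|w i| := by
  simp only [mem_alignedSet]
  rcases lt_or_ge 0 (w i) with h | h
  · cases hy : y i <;> simp [spin, h, abs_of_pos]
  · cases hy : y i <;> simp [spin, h, not_lt.2 h, abs_of_nonpos]

theorem sum_mul_spin_add_le_of_alignedSet_ssubset {ι : Type*} [Fintype ι] {α : ℝ}
    {w : ι → ℝ} (hw : ∀ i, α ≤ |w i|) {y z : ι → Bool}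
    (h : alignedSet w y ⊂ alignedSet w z) :
    ∑ i, w i * spin (y i) + 2 * α ≤ ∑ i, w i * spin (z i) := by
  classical
  have hsub := h.subset
  obtain ⟨j, hjz, hjy⟩ := exists_of_ssubset h
  have hmono : ∀ i, 0 ≤ w i * spin (z i) - w i * spin (y i) := by
    intro i
    have := abs_nonneg (w i)
    rw [mul_spin_eq_ite, mul_spin_eq_ite]
    split_ifs with h₁ h₂ h₂
    · linarith
    · linarith
    · exact absurd (hsub h₂) h₁
    · linarith
  have hj : 2 * α ≤ w j * spin (z j) - w j * spin (y j) := by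
    rw [mul_spin_eq_ite, mul_spin_eq_ite, if_pos hjz, if_neg hjy]
    linarith [hw j]
  have hsum := single_le_sum (fun i _ => hmono i) (mem_univ j)
  rw [sum_sub_distrib] at hsum
  linarith

theorem card_sum_mul_spin_mem_Ioo_le {ι : Type*} [Fintype ι] [DecidableEq ι] {α : ℝ}
    {w : ι → ℝ} (hw : ∀ i, α ≤ |w i|) (t₀ : ℝ) :
    (univ.filter fun y : ι → Bool =>
        t₀ - α < ∑ i, w i * spin (y i) ∧ ∑ i, w i * spin (y i) < t₀ + α).card
      ≤ (Fintype.card ι).choose (Fintype.card ι / 2) := by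
  rw [← card_image_of_injective _ (alignedSet_injective w)]
  refine IsAntichain.sperner ?_
  intro s hs t ht hne hst
  simp only [coe_image, coe_filter, mem_univ, true_and, Set.mem_image, Set.mem_ofPred_eq] at hs ht
  obtain ⟨y, ⟨hy, -⟩, rfl⟩ := hs
  obtain ⟨z, ⟨-, hz⟩, rfl⟩ := ht
  have := sum_mul_spin_add_le_of_alignedSet_ssubset hw (Finset.ssubset_iff_subset_ne.2 ⟨hst, hne⟩)
  linarith

/-- Erdős' Littlewood–Offord anti-concentration lemma. -/
theorem stmt10 (r : ℕ) (hr : 1 ≤ r) (α : ℝ) (hα : 0 < α)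
    (w : Fin r → ℝ) (hw : ∀ i, α ≤ |w i|) (t₀ : ℝ) :
    ((Finset.univ.filter (fun y : Fin r → Bool =>
          t₀ - α < ∑ i, w i * spin (y i) ∧ ∑ i, w i * spin (y i) < t₀ + α)).card : ℝ)
        / 2 ^ r
      ≤ (r.choose (r / 2) : ℝ) / 2 ^ r
    ∧ (r.choose (r / 2) : ℝ) / 2 ^ r ≤ 1 / 2 := by
  constructor
  · gcongr
    simpa using card_sum_mul_spin_mem_Ioo_le hw t₀
  · obtain ⟨n, rfl⟩ := Nat.exists_eq_add_of_le' hr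
    have h : ((n + 1).choose ((n + 1) / 2) : ℝ) ≤ 2 ^ n := by
      exact_mod_cast Nat.choose_succ_le_two_pow n _
    rw [div_le_div_iff₀ (by positivity) two_pos, pow_succ]
    linarith
end
end
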